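/- For every alternating bilinear form T on ℝ^n and all u, v ∈ ℝ^n, Tr( ĉ(u) ĉ(v) ∑_{1≤k<l≤n} T(e_k,e_l) ĉ(e_k) ĉ(e_l) ) = −T(u,v) · 2^n. -/

import Mathlib

open MeasureTheory

noncomputable section

/-- Euclidean space `ℝ^n` with its standard inner product. -/
abbrev Eucl (n : ℕ) := EuclideanSpace ℝ (Fin n)

/-- The exterior algebra `Λℝ^n`. -/
abbrev ExtAlg (n : ℕ) := ExteriorAlgebra ℝ (Eucl n)

/-- The standard orthonormal basis vector `e_i` of `ℝ^n`. -/
def e (n : ℕ) (i : Fin n) : Eucl n := EuclideanSpace.single i 1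

/-- Left exterior multiplication `ε(x)` on `Λℝ^n`. -/
def eps {n : ℕ} (x : Eucl n) : Module.End ℝ (ExtAlg n) :=
  LinearMap.mulLeft ℝ (ExteriorAlgebra.ι ℝ x)

/-- Interior multiplication (contraction) `ι(x)` on `Λℝ^n`, determined by the inner product. -/
def iot {n : ℕ} (x : Eucl n) : Module.End ℝ (ExtAlg n) :=
  CliffordAlgebra.contractLeft (Q := (0 : QuadraticForm ℝ (Eucl n))) (innerSL ℝ x).toLinearMap

/-- The Clifford action `c(x) = ε(x) − ι(x)`. -/
def c {n : ℕ} (x : Eucl n) : Module.End ℝ (ExtAlg n) := eps x - iot x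

/-- The Clifford action `ĉ(x) = ε(x) + ι(x)`. -/
def hc {n : ℕ} (x : Eucl n) : Module.End ℝ (ExtAlg n) := eps x + iot x

/-- The trace of a linear endomorphism of `Λℝ^n`. -/
def Tr {n : ℕ} : Module.End ℝ (ExtAlg n) →ₗ[ℝ] ℝ := LinearMap.trace ℝ (ExtAlg n)

theorem hc_mul_hc_add_swap {n : ℕ} (x y : Eucl n) :
    hc x * hc y + hc y * hc x = (2 * inner ℝ x y) • (1 : Module.End ℝ (ExtAlg n)) := by
  apply LinearMap.ext
  intro z
  have h₁ : iot x (iot y z) = -iot y (iot x z) := CliffordAlgebra.contractLeft_comm _ _ z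
  have h₂ : ∀ a b : Eucl n, iot a (ExteriorAlgebra.ι ℝ b * z)
      = (inner ℝ a b : ℝ) • z - ExteriorAlgebra.ι ℝ b * iot a z := fun a b =>
    CliffordAlgebra.contractLeft_ι_mul _ b z
  have h₃ : ExteriorAlgebra.ι ℝ x * (ExteriorAlgebra.ι ℝ y * z)
      = -(ExteriorAlgebra.ι ℝ y * (ExteriorAlgebra.ι ℝ x * z)) := by
    rw [← mul_assoc, ← mul_assoc, ← neg_mul,
      eq_neg_of_add_eq_zero_left (ExteriorAlgebra.ι_add_mul_swap x y)]
  simp only [hc, eps, LinearMap.add_apply, Module.End.mul_apply, LinearMap.mulLeft_apply,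
    mul_add, LinearMap.smul_apply, Module.End.one_apply, h₂, h₁, h₃,
    real_inner_comm x y, two_mul, add_smul]
  abel

theorem Tr_one (n : ℕ) : Tr (1 : Module.End ℝ (ExtAlg n)) = 2 ^ n := by
  let b := (EuclideanSpace.basisFun (Fin n) ℝ).toBasis.ExteriorAlgebra
  have := Module.Finite.of_basis b
  have := Module.Free.of_basis b
  rw [Tr, LinearMap.trace_one, Module.finrank_eq_card_basis b]
  simp

theorem Tr_hc_mul_hc {n : ℕ} (x y : Eucl n) : Tr (hc x * hc y) = inner ℝ x y * 2 ^ n := by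
  have h := congrArg Tr (hc_mul_hc_add_swap x y)
  have hs : Tr (hc y * hc x) = Tr (hc x * hc y) := LinearMap.trace_mul_comm ℝ _ _
  rw [map_add, hs, map_smul, Tr_one, smul_eq_mul] at h
  linarith

theorem Tr_hc_mul_hc_mul_hc_mul_hc {n : ℕ} (x y z w : Eucl n) :
    Tr (hc x * hc y * (hc z * hc w)) = (inner ℝ x y * inner ℝ z w
      - inner ℝ x z * inner ℝ y w + inner ℝ x w * inner ℝ y z) * 2 ^ n := by
  have swap (a b : Eucl n) : hc a * hc b
      = (2 * inner ℝ a b) • (1 : Module.End ℝ (ExtAlg n)) - hc b * hc a :=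
    eq_sub_of_add_eq (hc_mul_hc_add_swap a b)
  have hcyc : Tr (hc y * hc z * hc w * hc x) = Tr (hc x * hc y * (hc z * hc w)) := by
    rw [Tr, LinearMap.trace_mul_comm]
    simp only [mul_assoc]
  have hmove : hc x * hc y * (hc z * hc w) = (2 * inner ℝ x y) • (hc z * hc w)
      - (2 * inner ℝ x z) • (hc y * hc w) + (2 * inner ℝ x w) • (hc y * hc z)
      - hc y * hc z * hc w * hc x := by
    calc hc x * hc y * (hc z * hc w)
        = (2 * inner ℝ x y) • (hc z * hc w) - hc y * (hc x * hc z) * hc w := by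
          rw [swap x y]; simp only [sub_mul, smul_mul_assoc, one_mul, mul_assoc]
      _ = (2 * inner ℝ x y) • (hc z * hc w) - (2 * inner ℝ x z) • (hc y * hc w)
          + hc y * hc z * (hc x * hc w) := by
          rw [swap x z]
          simp only [sub_mul, mul_sub, smul_mul_assoc, mul_smul_comm, mul_one, mul_assoc]
          abel
      _ = _ := by
          rw [swap x w]
          simp only [mul_sub, mul_smul_comm, mul_one, mul_assoc]
          abel
  have h := congrArg Tr hmove
  simp only [map_sub, map_add, map_smul, hcyc, Tr_hc_mul_hc, smul_eq_mul] at h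
  linarith

theorem alternating_apply_eq_sum {n : ℕ} (T : Eucl n [⋀^Fin 2]→ₗ[ℝ] ℝ) (u v : Eucl n) :
    T ![u, v] = ∑ k : Fin n, ∑ l : Fin n,
      if k < l then T ![e n k, e n l] * (u k * v l - u l * v k) else 0 := by
  have expand (x : Eucl n) : x = ∑ i, x i • e n i := by
    simpa [e] using ((EuclideanSpace.basisFun (Fin n) ℝ).sum_repr x).symm
  have hleft (y : Eucl n) : T ![u, y] = ∑ k, u k * T ![e n k, y] := by
    let L : Eucl n →ₗ[ℝ] ℝ := T.toMultilinearMap.toLinearMap ![0, y] 0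
    have hL (x : Eucl n) : L x = T ![x, y] := by
      refine congrArg T (funext fun i => ?_)
      fin_cases i <;> simp
    rw [← hL]
    conv_lhs => rw [expand u, map_sum]
    simp only [map_smul, smul_eq_mul]
    simp only [hL]
  have hright (x : Eucl n) : T ![x, v] = ∑ l, v l * T ![x, e n l] := by
    let L : Eucl n →ₗ[ℝ] ℝ := T.toMultilinearMap.toLinearMap ![x, 0] 1
    have hL (y : Eucl n) : L y = T ![x, y] := by
      refine congrArg T (funext fun i => ?_)
      fin_cases i <;> simp
    rw [← hL]
    conv_lhs => rw [expand v, map_sum]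
    simp only [map_smul, smul_eq_mul]
    simp only [hL]
  have hswap (x y : Eucl n) : T ![y, x] = -T ![x, y] := by
    have h := T.map_swap ![x, y] (show (0 : Fin 2) ≠ 1 by decide)
    rw [← h]
    congr 1
    ext i : 1
    fin_cases i <;> simp
  have hsplit (k l : Fin n) : u k * (v l * T ![e n k, e n l])
      = (if k < l then T ![e n k, e n l] * (u k * v l) else 0)
        + (if l < k then -(T ![e n l, e n k] * (u k * v l)) else 0) := by
    rcases lt_trichotomy k l with h | h | h
    · simp only [h, h.not_gt, if_true, if_false]; ring
    · subst h
      have := hswap (e n k) (e n k)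
      have : T ![e n k, e n k] = 0 := by linarith
      simp [this]
    · simp only [h, h.not_gt, if_true, if_false, hswap (e n l) (e n k)]; ring
  rw [hleft]
  simp only [hright, Finset.mul_sum, hsplit, Finset.sum_add_distrib]
  conv_lhs => enter [2]; rw [Finset.sum_comm]
  simp only [← Finset.sum_add_distrib]
  refine Finset.sum_congr rfl fun k _ => Finset.sum_congr rfl fun l _ => ?_
  split_ifs <;> ring

theorem stmt_1 (n : ℕ) (hn : 0 < n) (T : Eucl n [⋀^Fin 2]→ₗ[ℝ] ℝ) (u v : Eucl n) :
    Tr (hc u * hc v * ∑ k : Fin n, ∑ l : Fin n,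
        if k < l then T ![e n k, e n l] • (hc (e n k) * hc (e n l)) else 0)
      = -T ![u, v] * 2 ^ n := by
  have he (x : Eucl n) (k : Fin n) : inner ℝ x (e n k) = x k := by
    simp [e, EuclideanSpace.inner_single_right]
  rw [alternating_apply_eq_sum T u v]
  simp only [Finset.mul_sum, Finset.sum_mul, map_sum, ← Finset.sum_neg_distrib]
  refine Finset.sum_congr rfl fun k _ => Finset.sum_congr rfl fun l _ => ?_
  split_ifs with h
  · rw [mul_smul_comm, map_smul, Tr_hc_mul_hc_mul_hc_mul_hc]
    have hkl : e n k l = 0 := by simp [e, h.ne']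
    simp only [he, smul_eq_mul, hkl]
    ring
  · simp
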